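/- arXiv:0906.3385 — 4 statements merged into one kernel-verified Lean document; each statement's English description precedes it below -/
import Mathlib

section
/- For every N ≥ 1 and all u, v, w ∈ (0,∞), the average of the generating functions over all 2^N configurations has the explicit expression (1/2^N) Σ_{ξ_N} Z_{ξ_N}(u,v,w) = 1 + Σ_{t=1}^{N} Σ_{s=1}^{⌊t/2⌋} C(N−t+s, s) · C(t−s−1, s−1) · ((u+v)/4)^s · (w/2)^{t−2s}, where C(·,·) denotes the binomial coefficient and ⌊·⌋ the integer part. -/
open scoped BigOperators

/-- `p = (i, j)` is a dimer on the colouring `ξ` of `N` sites: `i < j`, sites `i` and `j`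
have the same colour, and no site strictly between them has that colour. -/
def IsDimer (N : ℕ) (ξ : Fin N → Bool) (p : Fin N × Fin N) : Prop :=
  p.1 < p.2 ∧ ξ p.1 = ξ p.2 ∧ ∀ k : Fin N, p.1 < k → k < p.2 → ξ k ≠ ξ p.1

/-- A coloured hard-dimer on `ξ`: a finite set of dimers whose closed intervals are
pairwise disjoint. -/
def IsHardDimer (N : ℕ) (ξ : Fin N → Bool) (D : Finset (Fin N × Fin N)) : Prop :=
  (∀ p ∈ D, IsDimer N ξ p) ∧ ∀ p ∈ D, ∀ q ∈ D, p ≠ q → p.2 < q.1 ∨ q.2 < p.1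

/-- Number of blue dimers (blue = `true`). -/
def nb (N : ℕ) (ξ : Fin N → Bool) (D : Finset (Fin N × Fin N)) : ℕ :=
  (D.filter fun p => ξ p.1 = true).card

/-- Number of red dimers (red = `false`). -/
def nr (N : ℕ) (ξ : Fin N → Bool) (D : Finset (Fin N × Fin N)) : ℕ :=
  (D.filter fun p => ξ p.1 = false).card

open scoped Classical in
/-- Number of sites lying strictly between the endpoints of some dimer of `D`. -/
noncomputable def nbr (N : ℕ) (D : Finset (Fin N × Fin N)) : ℕ :=
  (Finset.univ.filter fun k : Fin N => ∃ p ∈ D, p.1 < k ∧ k < p.2).card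

open scoped Classical in
/-- The generating function `Z_{ξ_N}(u,v,w)` of coloured hard-dimers on `ξ`. -/
noncomputable def Z (N : ℕ) (ξ : Fin N → Bool) (u v w : ℝ) : ℝ :=
  ∑ D ∈ Finset.univ.filter (fun D => IsHardDimer N ξ D),
    u ^ nb N ξ D * v ^ nr N ξ D * w ^ nbr N D

/-- A finite set of nondegenerate intervals whose closures are pairwise disjoint. -/
def IsPacking {α : Type*} [LT α] (D : Finset (α × α)) : Prop :=
  (∀ p ∈ D, p.1 < p.2) ∧ ∀ p ∈ D, ∀ q ∈ D, p ≠ q → p.2 < q.1 ∨ q.2 < p.1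

section Colourings

variable {N : ℕ}

/-- Functions of a random colouring which depend on disjoint sets of sites are independent. -/
lemma sum_mul_sum_eq_of_dependsOn (S : Finset (Fin N)) (f g : (Fin N → Bool) → ℝ)
    (hf : ∀ ξ η : Fin N → Bool, (∀ k ∈ S, ξ k = η k) → f ξ = f η)
    (hg : ∀ ξ η : Fin N → Bool, (∀ k ∉ S, ξ k = η k) → g ξ = g η) :
    (∑ ξ, f ξ) * ∑ ξ, g ξ = 2 ^ N * ∑ ξ, f ξ * g ξ := by
  have h1 : (∑ ξ, f ξ) * ∑ ξ, g ξ
      = ∑ x : (Fin N → Bool) × (Fin N → Bool), f x.1 * g x.2 := by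
    rw [Finset.sum_mul_sum, Fintype.sum_prod_type]
  have h2 : (2 : ℝ) ^ N * ∑ ξ, f ξ * g ξ
      = ∑ x : (Fin N → Bool) × (Fin N → Bool), f x.1 * g x.1 := by
    rw [Fintype.sum_prod_type]
    simp [Finset.mul_sum]
  rw [h1, h2]
  refine Finset.sum_nbij' (fun x => (S.piecewise x.1 x.2, S.piecewise x.2 x.1))
    (fun x => (S.piecewise x.1 x.2, S.piecewise x.2 x.1)) (by simp) (by simp) ?_ ?_ ?_
  · rintro ⟨ξ, η⟩ -
    ext k <;> by_cases hk : k ∈ S <;> simp [hk]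
  · rintro ⟨ξ, η⟩ -
    ext k <;> by_cases hk : k ∈ S <;> simp [hk]
  · rintro ⟨ξ, η⟩ -
    congr 1
    · exact hf _ _ fun k hk => by simp [hk]
    · exact hg _ _ fun k hk => by simp [hk]

open scoped Classical in
lemma card_filter_isDimer_mul (p : Fin N × Fin N) (hp : p.1 < p.2) (c : Bool) :
    (Finset.univ.filter fun ξ : Fin N → Bool => IsDimer N ξ p ∧ ξ p.1 = c).card
      * 2 ^ (p.2.val - p.1.val + 1) = 2 ^ N := by
  have h : (Finset.univ.filter fun ξ : Fin N → Bool => IsDimer N ξ p ∧ ξ p.1 = c)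
      = Fintype.piFinset fun k => if k ∈ Finset.Icc p.1 p.2 then
          {if k = p.1 ∨ k = p.2 then c else !c} else Finset.univ := by
    ext ξ
    simp only [Finset.mem_filter, Finset.mem_univ, true_and, Fintype.mem_piFinset]
    constructor
    · rintro ⟨⟨-, h1, h2⟩, h3⟩ k
      split_ifs with hk hk'
      · rcases hk' with rfl | rfl
        · simpa using h3
        · simpa [← h1] using h3
      · rw [Finset.mem_Icc] at hk
        push Not at hk'
        have := h2 k (lt_of_le_of_ne hk.1 hk'.1.symm) (lt_of_le_of_ne hk.2 hk'.2)
        rw [h3] at this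
        simpa using Bool.eq_not_of_ne this
      · simp
    · intro h
      have h1 : ξ p.1 = c := by simpa [hp.le] using h p.1
      have h2 : ξ p.2 = c := by simpa [hp.le] using h p.2
      refine ⟨⟨hp, h1.trans h2.symm, fun k hk hk' => ?_⟩, h1⟩
      have := h k
      rw [if_pos (Finset.mem_Icc.2 ⟨hk.le, hk'.le⟩), if_neg (by
        push Not; exact ⟨hk.ne', hk'.ne⟩), Finset.mem_singleton] at this
      rw [this, h1]
      simp
  have hcard : (Finset.Icc p.1 p.2).card = p.2.val - p.1.val + 1 := by
    rw [Fin.card_Icc]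
    have : p.1.val < p.2.val := hp
    omega
  rw [h, Fintype.card_piFinset]
  have h' : ∀ k : Fin N, (if k ∈ Finset.Icc p.1 p.2 then
      ({if k = p.1 ∨ k = p.2 then c else !c} : Finset Bool) else Finset.univ).card
        = if k ∈ Finset.Icc p.1 p.2 then 1 else 2 := by
    intro k
    split_ifs <;> simp
  rw [Finset.prod_congr rfl fun k _ => h' k, ← hcard, ← Finset.prod_const,
    ← Finset.prod_filter_mul_prod_filter_not Finset.univ (· ∈ Finset.Icc p.1 p.2)]
  simp only [Finset.filter_mem_eq_inter, Finset.univ_inter]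
  rw [Finset.prod_congr rfl fun k hk => if_pos hk,
    Finset.prod_congr rfl fun k hk => if_neg (Finset.mem_filter.1 hk).2]
  have := Finset.card_filter_add_card_filter_not (s := (Finset.univ : Finset (Fin N)))
    (· ∈ Finset.Icc p.1 p.2)
  simp only [Finset.filter_mem_eq_inter, Finset.univ_inter, Finset.card_univ,
    Fintype.card_fin] at this
  rw [Finset.prod_const_one, one_mul, Finset.prod_const, Finset.prod_const, ← pow_add, add_comm,
    this]

open scoped Classical in
/-- The contribution of the interval `p` to the weight of a hard-dimer on `ξ`. -/
noncomputable def dimerWeight (u v w : ℝ) (ξ : Fin N → Bool) (p : Fin N × Fin N) : ℝ :=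
  if IsDimer N ξ p then (if ξ p.1 = true then u else v) * w ^ (p.2.val - p.1.val - 1) else 0

lemma sum_dimerWeight (u v w : ℝ) (p : Fin N × Fin N) (hp : p.1 < p.2) :
    ∑ ξ : Fin N → Bool, dimerWeight u v w ξ p
      = 2 ^ N * ((u + v) / 4 * (w / 2) ^ (p.2.val - p.1.val - 1)) := by
  classical
  have h : ∀ ξ : Fin N → Bool, dimerWeight u v w ξ p
      = (if IsDimer N ξ p ∧ ξ p.1 = true then u * w ^ (p.2.val - p.1.val - 1) else 0)
        + (if IsDimer N ξ p ∧ ξ p.1 = false then v * w ^ (p.2.val - p.1.val - 1) else 0) := by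
    intro ξ
    unfold dimerWeight
    by_cases h1 : IsDimer N ξ p <;> cases h2 : ξ p.1 <;> simp [h1]
  simp_rw [h]
  rw [Finset.sum_add_distrib, ← Finset.sum_filter, ← Finset.sum_filter, Finset.sum_const,
    Finset.sum_const, nsmul_eq_mul, nsmul_eq_mul]
  have ht := card_filter_isDimer_mul p hp true
  have hf := card_filter_isDimer_mul p hp false
  set x := (Finset.univ.filter fun ξ : Fin N → Bool => IsDimer N ξ p ∧ ξ p.1 = true).card
  set y := (Finset.univ.filter fun ξ : Fin N → Bool => IsDimer N ξ p ∧ ξ p.1 = false).card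
  obtain ⟨l, hl⟩ : ∃ l, p.2.val - p.1.val = l + 1 :=
    ⟨p.2.val - p.1.val - 1, by have : p.1.val < p.2.val := hp; omega⟩
  rw [hl] at ht hf ⊢
  have ht' : (x : ℝ) * 2 ^ (l + 1 + 1) = 2 ^ N := by exact_mod_cast ht
  have hf' : (y : ℝ) * 2 ^ (l + 1 + 1) = 2 ^ N := by exact_mod_cast hf
  have hxy : (y : ℝ) = x := mul_right_cancel₀ (by positivity) (hf'.trans ht'.symm)
  rw [hxy, ← ht', Nat.add_sub_cancel, div_pow, pow_succ, pow_succ]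
  field_simp
  ring

lemma dimerWeight_congr (u v w : ℝ) (p : Fin N × Fin N) (ξ η : Fin N → Bool)
    (h : ∀ k ∈ Finset.Icc p.1 p.2, ξ k = η k) :
    dimerWeight u v w ξ p = dimerWeight u v w η p := by
  by_cases hp : p.1 < p.2
  · have h1 := h p.1 (by simp [hp.le])
    have h2 := h p.2 (by simp [hp.le])
    have : IsDimer N ξ p ↔ IsDimer N η p := by
      unfold IsDimer
      rw [h1, h2]
      refine and_congr_right fun _ => and_congr_right fun _ => forall_congr' fun k => ?_
      refine forall_congr' fun hk => forall_congr' fun hk' => ?_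
      rw [h k (Finset.mem_Icc.2 ⟨hk.le, hk'.le⟩)]
    unfold dimerWeight
    rw [h1]
    by_cases h3 : IsDimer N η p
    · rw [if_pos h3, if_pos (this.2 h3)]
    · rw [if_neg h3, if_neg (mt this.1 h3)]
  · simp [dimerWeight, IsDimer, hp]

lemma IsPacking.of_insert {α : Type*} [LT α] [DecidableEq α] {p : α × α} {D : Finset (α × α)}
    (h : IsPacking (insert p D)) : IsPacking D :=
  ⟨fun q hq => h.1 q (Finset.mem_insert_of_mem hq), fun q hq r hr =>
    h.2 q (Finset.mem_insert_of_mem hq) r (Finset.mem_insert_of_mem hr)⟩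

lemma sum_prod_dimerWeight (u v w : ℝ) (D : Finset (Fin N × Fin N)) (hD : IsPacking D) :
    ∑ ξ : Fin N → Bool, ∏ p ∈ D, dimerWeight u v w ξ p
      = 2 ^ N * ∏ p ∈ D, ((u + v) / 4 * (w / 2) ^ (p.2.val - p.1.val - 1)) := by
  classical
  induction D using Finset.induction_on with
  | empty => simp
  | insert p D hpD ih =>
    have hp : p.1 < p.2 := hD.1 p (Finset.mem_insert_self _ _)
    have key := sum_mul_sum_eq_of_dependsOn (Finset.Icc p.1 p.2)
      (fun ξ => dimerWeight u v w ξ p) (fun ξ => ∏ q ∈ D, dimerWeight u v w ξ q)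
      (fun ξ η h => dimerWeight_congr u v w p ξ η h)
      (fun ξ η h => Finset.prod_congr rfl fun q hq => dimerWeight_congr u v w q ξ η
        fun k hk => h k (by
          rw [Finset.mem_Icc] at hk ⊢
          rcases hD.2 p (Finset.mem_insert_self _ _) q (Finset.mem_insert_of_mem hq)
            (fun e => hpD (e ▸ hq)) with h | h
          · exact fun h' => absurd (h'.2.trans_lt h) (not_lt.2 hk.1)
          · exact fun h' => absurd (hk.2.trans_lt h) (not_lt.2 h'.1)))
    rw [sum_dimerWeight u v w p hp, ih hD.of_insert] at key
    simp_rw [Finset.prod_insert hpD]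
    refine mul_left_cancel₀ (pow_ne_zero N (two_ne_zero' ℝ)) (key.symm.trans ?_)
    ring

lemma nbr_eq_sum (D : Finset (Fin N × Fin N)) (hD : IsPacking D) :
    nbr N D = ∑ p ∈ D, (p.2.val - p.1.val - 1) := by
  classical
  have h : (Finset.univ.filter fun k : Fin N => ∃ p ∈ D, p.1 < k ∧ k < p.2)
      = D.biUnion fun p => Finset.Ioo p.1 p.2 := by
    ext k
    simp
  unfold nbr
  rw [h, Finset.card_biUnion]
  · simp
  · intro p hp q hq hpq
    rw [Function.onFun, Finset.disjoint_left]
    intro k hk hk'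
    rw [Finset.mem_Ioo] at hk hk'
    rcases hD.2 p hp q hq hpq with h | h
    · exact absurd (hk.2.trans h) hk'.1.asymm
    · exact absurd (hk'.2.trans h) hk.1.asymm

open scoped Classical in
lemma hardDimer_weight_eq_prod (u v w : ℝ) (ξ : Fin N → Bool) (D : Finset (Fin N × Fin N))
    (hD : IsPacking D) :
    (if IsHardDimer N ξ D then u ^ nb N ξ D * v ^ nr N ξ D * w ^ nbr N D else 0)
      = ∏ p ∈ D, dimerWeight u v w ξ p := by
  by_cases h : ∀ p ∈ D, IsDimer N ξ p
  · rw [if_pos ⟨h, hD.2⟩, nbr_eq_sum D hD, ← Finset.prod_pow_eq_pow_sum]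
    rw [Finset.prod_congr rfl fun p hp => show dimerWeight u v w ξ p = _ from if_pos (h p hp),
      Finset.prod_mul_distrib, Finset.prod_ite, Finset.prod_const, Finset.prod_const]
    simp only [nb, nr, Bool.not_eq_true]
  · rw [if_neg fun h' => h h'.1]
    push Not at h
    obtain ⟨p, hp, hp'⟩ := h
    exact (Finset.prod_eq_zero hp (if_neg hp')).symm

open scoped Classical in
lemma sum_Z_eq_sum_packing (u v w : ℝ) :
    ∑ ξ : Fin N → Bool, Z N ξ u v w
      = 2 ^ N * ∑ D ∈ Finset.univ.filter fun D : Finset (Fin N × Fin N) => IsPacking D,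
          ∏ p ∈ D, ((u + v) / 4 * (w / 2) ^ (p.2.val - p.1.val - 1)) := by
  simp only [Z, Finset.sum_filter]
  rw [Finset.sum_comm, Finset.mul_sum]
  refine Finset.sum_congr rfl fun D _ => ?_
  split_ifs with hD
  · rw [← sum_prod_dimerWeight u v w D hD]
    exact Finset.sum_congr rfl fun ξ _ => hardDimer_weight_eq_prod u v w ξ D hD
  · rw [mul_zero]
    refine Finset.sum_eq_zero fun ξ _ => if_neg fun h => hD ⟨fun p hp => (h.1 p hp).1, h.2⟩

end Colourings

section Packings

open scoped Classical in
/-- The packings by intervals with endpoints in `{0, …, n - 1}`. -/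
noncomputable def packings (n : ℕ) : Finset (Finset (ℕ × ℕ)) :=
  (Finset.range n ×ˢ Finset.range n).powerset.filter fun D => IsPacking D

lemma mem_packings {n : ℕ} {D : Finset (ℕ × ℕ)} :
    D ∈ packings n ↔ IsPacking D ∧ ∀ p ∈ D, p.2 < n := by
  simp only [packings, Finset.mem_filter, Finset.mem_powerset, Finset.subset_iff,
    Finset.mem_product, Finset.mem_range]
  exact ⟨fun h => ⟨h.2, fun p hp => (h.1 hp).2⟩,
    fun h => ⟨fun p hp => ⟨(h.1.1 p hp).trans (h.2 p hp), h.2 p hp⟩, h.1⟩⟩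

/-- The total weight of the packings in `{0, …, n - 1}`, where an interval with `m` interior
points has weight `a * b ^ m`. -/
noncomputable def packingSum (a b : ℝ) (n : ℕ) : ℝ :=
  ∑ D ∈ packings n, ∏ p ∈ D, (a * b ^ (p.2 - p.1 - 1))

open scoped Classical in
lemma sum_fin_packing_eq (a b : ℝ) (N : ℕ) :
    ∑ D ∈ Finset.univ.filter fun D : Finset (Fin N × Fin N) => IsPacking D,
        ∏ p ∈ D, (a * b ^ (p.2.val - p.1.val - 1)) = packingSum a b N := by
  let e : Fin N × Fin N ↪ ℕ × ℕ := Fin.valEmbedding.prodMap Fin.valEmbedding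
  have hpack : ∀ D : Finset (Fin N × Fin N), IsPacking (D.map e) ↔ IsPacking D := by
    intro D
    simp only [IsPacking, Finset.forall_mem_map, ne_eq, e.injective.eq_iff]
    rfl
  refine Finset.sum_nbij (fun D => D.map e) ?_ ?_ ?_ ?_
  · intro D hD
    rw [mem_packings, hpack]
    refine ⟨(Finset.mem_filter.1 hD).2, ?_⟩
    simp only [Finset.forall_mem_map]
    exact fun p _ => p.2.isLt
  · exact (Finset.map_injective e).injOn
  · intro E hE
    rw [Finset.mem_coe, mem_packings] at hE
    have hmap : (Finset.univ.filter fun p => e p ∈ E).map e = E := by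
      ext q
      simp only [Finset.mem_map, Finset.mem_filter, Finset.mem_univ, true_and]
      constructor
      · rintro ⟨p, hp, rfl⟩
        exact hp
      · intro hq
        have h2 := hE.2 q hq
        exact ⟨(⟨q.1, (hE.1.1 q hq).trans h2⟩, ⟨q.2, h2⟩), hq, rfl⟩
    refine ⟨Finset.univ.filter fun p => e p ∈ E, ?_, hmap⟩
    simp only [Finset.coe_filter, Finset.mem_univ, true_and, Set.mem_ofPred_eq]
    rw [← hpack, hmap]
    exact hE.1
  · intro D _
    rw [Finset.prod_map]
    rfl

lemma packingSum_zero (a b : ℝ) : packingSum a b 0 = 1 := by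
  have : packings 0 = {∅} := by
    ext D
    rw [mem_packings, Finset.mem_singleton]
    constructor
    · exact fun h => Finset.eq_empty_of_forall_notMem fun p hp => absurd (h.2 p hp) (by simp)
    · rintro rfl
      simp [IsPacking]
  simp [packingSum, this]

lemma notMem_of_mem_packings {n i : ℕ} (hi : i < n) {D : Finset (ℕ × ℕ)} (hD : D ∈ packings i)
    (j : ℕ) : (j, n) ∉ D := fun h => absurd ((mem_packings.1 hD).2 _ h) (by simp; omega)

/-- Splitting off the interval that ends at the last site. -/
lemma packings_succ (n : ℕ) :
    packings (n + 1)
      = packings n ∪ (Finset.range n).biUnion fun i => (packings i).image (insert (i, n)) := by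
  ext D
  simp only [Finset.mem_union, Finset.mem_biUnion, Finset.mem_range, Finset.mem_image]
  constructor
  · intro hD
    rw [mem_packings] at hD
    by_cases h : ∃ i, (i, n) ∈ D
    · obtain ⟨i, hi⟩ := h
      have hin : i < n := hD.1.1 _ hi
      refine Or.inr ⟨i, hin, D.erase (i, n), ?_, Finset.insert_erase hi⟩
      rw [mem_packings]
      refine ⟨⟨fun p hp => hD.1.1 p (Finset.mem_of_mem_erase hp), fun p hp q hq =>
        hD.1.2 p (Finset.mem_of_mem_erase hp) q (Finset.mem_of_mem_erase hq)⟩, fun p hp => ?_⟩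
      have hpD := Finset.mem_of_mem_erase hp
      have h1 := hD.1.1 p hpD
      have h2 := hD.2 p hpD
      rcases hD.1.2 p hpD _ hi (Finset.ne_of_mem_erase hp) with h | h
      · exact h
      · simp only at h
        omega
    · left
      rw [mem_packings]
      refine ⟨hD.1, fun p hp => ?_⟩
      have h2 := hD.2 p hp
      rcases Nat.lt_succ_iff_lt_or_eq.1 h2 with h3 | h3
      · exact h3
      · exact absurd ⟨p.1, h3 ▸ hp⟩ h
  · rintro (h | ⟨i, hi, E, hE, rfl⟩)
    · rw [mem_packings] at h ⊢
      exact ⟨h.1, fun p hp => (h.2 p hp).trans n.lt_succ_self⟩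
    · rw [mem_packings] at hE ⊢
      refine ⟨⟨?_, ?_⟩, ?_⟩
      · intro p hp
        rcases Finset.mem_insert.1 hp with rfl | hp
        · exact hi
        · exact hE.1.1 p hp
      · intro p hp q hq hpq
        rcases Finset.mem_insert.1 hp with rfl | hp <;> rcases Finset.mem_insert.1 hq with rfl | hq
        · exact absurd rfl hpq
        · exact Or.inr (hE.2 q hq)
        · exact Or.inl (hE.2 p hp)
        · exact hE.1.2 p hp q hq hpq
      · intro p hp
        rcases Finset.mem_insert.1 hp with rfl | hp
        · exact n.lt_succ_self
        · have := hE.2 p hp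
          omega

lemma packingSum_succ (a b : ℝ) (n : ℕ) :
    packingSum a b (n + 1)
      = packingSum a b n + a * ∑ i ∈ Finset.range n, b ^ (n - i - 1) * packingSum a b i := by
  unfold packingSum
  rw [packings_succ, Finset.sum_union, Finset.sum_biUnion, Finset.mul_sum]
  · congr 1
    refine Finset.sum_congr rfl fun i hi => ?_
    rw [Finset.mem_range] at hi
    rw [Finset.sum_image, ← mul_assoc, Finset.mul_sum]
    · exact Finset.sum_congr rfl fun D hD =>
        Finset.prod_insert (notMem_of_mem_packings hi hD i)
    · intro D hD E hE h
      rw [← Finset.erase_insert (notMem_of_mem_packings hi hD i), h,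
        Finset.erase_insert (notMem_of_mem_packings hi hE i)]
  · intro i hi j hj hij
    rw [Function.onFun, Finset.disjoint_left]
    intro D hD hD'
    obtain ⟨E, hE, rfl⟩ := Finset.mem_image.1 hD
    obtain ⟨F, hF, hEF⟩ := Finset.mem_image.1 hD'
    have : (j, n) ∈ insert (i, n) E := hEF ▸ Finset.mem_insert_self _ _
    rcases Finset.mem_insert.1 this with h | h
    · exact hij (Prod.mk.inj h).1.symm
    · exact notMem_of_mem_packings (Finset.mem_range.1 hi) hE j h
  · rw [Finset.disjoint_left]
    intro D hD hD'
    simp only [Finset.mem_biUnion, Finset.mem_image] at hD'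
    obtain ⟨i, -, E, -, rfl⟩ := hD'
    exact absurd ((mem_packings.1 hD).2 _ (Finset.mem_insert_self _ _)) (lt_irrefl n)

lemma packingSum_one (a b : ℝ) : packingSum a b 1 = 1 := by
  simpa [packingSum_zero] using packingSum_succ a b 0

lemma packingSum_add_two (a b : ℝ) (n : ℕ) :
    packingSum a b (n + 2)
      = (1 + b) * packingSum a b (n + 1) + (a - b) * packingSum a b n := by
  have h : ∑ i ∈ Finset.range (n + 1), b ^ (n + 1 - i - 1) * packingSum a b i
      = b * ∑ i ∈ Finset.range n, b ^ (n - i - 1) * packingSum a b i + packingSum a b n := by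
    rw [Finset.sum_range_succ, Finset.mul_sum]
    congr 1
    · refine Finset.sum_congr rfl fun i hi => ?_
      rw [Finset.mem_range] at hi
      rw [← mul_assoc, ← pow_succ', show n + 1 - i - 1 = n - i - 1 + 1 by omega]
    · simp
  have h1 := packingSum_succ a b n
  rw [packingSum_succ a b (n + 1), h]
  linear_combination -b * h1

end Packings

section GeneratingSeries

open PowerSeries

/-- The generating series of `k ↦ k.choose s`. -/
noncomputable def chooseSeries (s : ℕ) : PowerSeries ℝ := mk fun k => (k.choose s : ℝ)

/-- The series `(1 - b X) ^ (-s)`. -/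
noncomputable def negPowSeries (b : ℝ) : ℕ → PowerSeries ℝ
  | 0 => 1
  | s + 1 => mk fun m => ((s + m).choose s : ℝ) * b ^ m

lemma one_sub_X_mul_chooseSeries_zero : (1 - X) * chooseSeries 0 = 1 := by
  ext n
  cases n <;> simp [chooseSeries, sub_mul, coeff_succ_X_mul, coeff_one]

lemma one_sub_X_mul_chooseSeries_succ (s : ℕ) :
    (1 - X) * chooseSeries (s + 1) = X * chooseSeries s := by
  ext n
  cases n <;> simp [chooseSeries, sub_mul, coeff_succ_X_mul, Nat.choose_succ_succ]

lemma mul_negPowSeries_succ (b : ℝ) (s : ℕ) :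
    (1 - C b * X) * negPowSeries b (s + 1) = negPowSeries b s := by
  ext n
  cases s with
  | zero =>
    cases n <;> simp [negPowSeries, sub_mul, mul_assoc, coeff_succ_X_mul, coeff_one, pow_succ']
  | succ s =>
    cases n with
    | zero => simp [negPowSeries, sub_mul, mul_assoc]
    | succ n =>
      simp only [negPowSeries, sub_mul, one_mul, mul_assoc, map_sub, coeff_mk, coeff_C_mul,
        coeff_succ_X_mul]
      rw [show s + 1 + (n + 1) = (s + 1 + n) + 1 by ring, Nat.choose_succ_succ,
        show s + (n + 1) = s + 1 + n by ring]
      push_cast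
      ring

/-- The generating series of the packings by `s` intervals. -/
noncomputable def packingSeries (b : ℝ) (s : ℕ) : PowerSeries ℝ :=
  X ^ s * chooseSeries s * negPowSeries b s

lemma mul_packingSeries_zero (b : ℝ) :
    (1 - X) * (1 - C b * X) * packingSeries b 0 = 1 - C b * X := by
  simp only [packingSeries, negPowSeries]
  linear_combination (1 - C b * X) * one_sub_X_mul_chooseSeries_zero

lemma mul_packingSeries_succ (b : ℝ) (s : ℕ) :
    (1 - X) * (1 - C b * X) * packingSeries b (s + 1) = X ^ 2 * packingSeries b s := by
  simp only [packingSeries]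
  calc (1 - X) * (1 - C b * X) * (X ^ (s + 1) * chooseSeries (s + 1) * negPowSeries b (s + 1))
      = X ^ (s + 1) * ((1 - X) * chooseSeries (s + 1))
          * ((1 - C b * X) * negPowSeries b (s + 1)) := by ring
    _ = _ := by
      rw [one_sub_X_mul_chooseSeries_succ, mul_negPowSeries_succ]
      ring

lemma mul_mk_packingSum (a b : ℝ) :
    (1 - X) * (1 - C b * X) * mk (packingSum a b)
      = 1 - C b * X + C a * X ^ 2 * mk (packingSum a b) := by
  have h : (1 - X) * (1 - C b * X) * mk (packingSum a b)
      = mk (packingSum a b) - X * mk (packingSum a b) - C b * (X * mk (packingSum a b))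
        + C b * (X * (X * mk (packingSum a b))) := by ring
  have h' : C a * X ^ 2 * mk (packingSum a b) = C a * (X * (X * mk (packingSum a b))) := by ring
  rw [h, h']
  ext n
  rcases n with _ | _ | n
  · simp [packingSum_zero]
  · simp [packingSum_zero, packingSum_one, coeff_succ_X_mul, coeff_one]
  · simp [packingSum_add_two, coeff_succ_X_mul, coeff_one]
    ring

lemma X_pow_dvd_mk_packingSum_sub (a b : ℝ) (M : ℕ) :
    X ^ (2 * M) ∣ mk (packingSum a b) - ∑ s ∈ Finset.range M, C a ^ s * packingSeries b s := by
  induction M with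
  | zero => simp
  | succ M ih =>
    have hK : (1 - X) * (1 - C b * X) * ∑ s ∈ Finset.range (M + 1), C a ^ s * packingSeries b s
        = 1 - C b * X
          + C a * X ^ 2 * ∑ s ∈ Finset.range M, C a ^ s * packingSeries b s := by
      rw [Finset.sum_range_succ', mul_add, pow_zero, one_mul, mul_packingSeries_zero, add_comm,
        Finset.mul_sum, Finset.mul_sum]
      congr 1
      refine Finset.sum_congr rfl fun s _ => ?_
      rw [pow_succ]
      linear_combination C a ^ s * C a * mul_packingSeries_succ b s
    have hunit : IsUnit ((1 - X) * (1 - C b * X) : PowerSeries ℝ) := by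
      rw [isUnit_iff_constantCoeff]
      simp
    rw [← hunit.dvd_mul_left]
    have : (1 - X) * (1 - C b * X) * (mk (packingSum a b)
        - ∑ s ∈ Finset.range (M + 1), C a ^ s * packingSeries b s)
        = C a * (X ^ 2 * (mk (packingSum a b)
          - ∑ s ∈ Finset.range M, C a ^ s * packingSeries b s)) := by
      linear_combination mul_mk_packingSum a b - hK
    rw [this, show 2 * (M + 1) = 2 + 2 * M by ring, pow_add]
    exact Dvd.dvd.mul_left (mul_dvd_mul_left _ ih) _

lemma coeff_packingSeries_zero (b : ℝ) (n : ℕ) : coeff n (packingSeries b 0) = 1 := by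
  simp [packingSeries, negPowSeries, chooseSeries]

lemma coeff_packingSeries_of_pos (b : ℝ) {s n : ℕ} (hs : 1 ≤ s) (hn : 2 * s ≤ n) :
    coeff n (packingSeries b s) = ∑ t ∈ Finset.Icc (2 * s) n,
      ((n - t + s).choose s : ℝ) * ((t - s - 1).choose (s - 1)) * b ^ (t - 2 * s) := by
  obtain ⟨r, rfl⟩ : ∃ r, s = r + 1 := ⟨s - 1, by omega⟩
  obtain ⟨d, rfl⟩ : ∃ d, n = 2 * (r + 1) + d := ⟨n - 2 * (r + 1), by omega⟩
  have hco : coeff (2 * (r + 1) + d) (packingSeries b (r + 1))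
      = ∑ m ∈ Finset.range (r + 1 + d + 1),
        ((r + m).choose r : ℝ) * b ^ m * ((r + 1 + d - m).choose (r + 1)) := by
    rw [packingSeries, mul_assoc, mul_comm (chooseSeries _),
      show 2 * (r + 1) + d = (r + 1 + d) + (r + 1) by ring, coeff_X_pow_mul, coeff_mul,
      Finset.Nat.sum_antidiagonal_eq_sum_range_succ_mk]
    simp [negPowSeries, chooseSeries]
  rw [hco, ← Finset.sum_subset (s₁ := Finset.range (d + 1))]
  · refine Finset.sum_nbij' (fun m => 2 * (r + 1) + m) (fun t => t - 2 * (r + 1)) ?_ ?_ ?_ ?_ ?_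
    · intro m hm
      simp only [Finset.mem_range, Finset.mem_Icc] at *
      omega
    · intro t ht
      simp only [Finset.mem_range, Finset.mem_Icc] at *
      omega
    · intro m _
      simp
    · intro t ht
      simp only [Finset.mem_Icc] at ht
      omega
    · intro m hm
      rw [Finset.mem_range] at hm
      rw [show 2 * (r + 1) + d - (2 * (r + 1) + m) + (r + 1) = r + 1 + d - m by omega,
        show 2 * (r + 1) + m - (r + 1) - 1 = r + m by omega, Nat.add_sub_cancel,
        Nat.add_sub_cancel_left]
      ring
  · exact Finset.range_subset_range.2 (by omega)
  · intro m _ hm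
    rw [Finset.mem_range] at hm
    rw [Nat.choose_eq_zero_of_lt (n := r + 1 + d - m) (by omega)]
    simp

lemma packingSum_eq (a b : ℝ) (N : ℕ) :
    packingSum a b N = 1 + ∑ t ∈ Finset.Icc 1 N, ∑ s ∈ Finset.Icc 1 (t / 2),
      ((N - t + s).choose s : ℝ) * ((t - s - 1).choose (s - 1)) * a ^ s * b ^ (t - 2 * s) := by
  have h := X_pow_dvd_iff.1 (X_pow_dvd_mk_packingSum_sub a b (N / 2 + 1)) N (by omega)
  rw [map_sub, coeff_mk, sub_eq_zero] at h
  rw [h, map_sum, Finset.sum_range_succ', add_comm, pow_zero, one_mul, coeff_packingSeries_zero]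
  congr 1
  rw [Finset.sum_comm' (t' := Finset.Icc 1 (N / 2)) (s' := fun s => Finset.Icc (2 * s) N)]
  · rw [Finset.range_eq_Ico, Finset.sum_Ico_add' (fun s => coeff N (C a ^ s * packingSeries b s))]
    refine Finset.sum_congr (by ext; simp) fun s hs => ?_
    rw [Finset.mem_Icc] at hs
    rw [← map_pow, coeff_C_mul, coeff_packingSeries_of_pos b hs.1 (by omega), Finset.mul_sum]
    exact Finset.sum_congr rfl fun t _ => by ring
  · intro t s
    simp only [Finset.mem_Icc]
    omega

end GeneratingSeries

/-- Lemma 2.1: explicit expression for the averaged generating function. -/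
theorem averaged_generating_function_explicit
    (N : ℕ) (hN : 1 ≤ N) (u v w : ℝ) (hu : 0 < u) (hv : 0 < v) (hw : 0 < w) :
    (1 / 2 ^ N) * ∑ ξ : Fin N → Bool, Z N ξ u v w =
      1 + ∑ t ∈ Finset.Icc 1 N, ∑ s ∈ Finset.Icc 1 (t / 2),
        ((N - t + s).choose s : ℝ) * ((t - s - 1).choose (s - 1)) *
          ((u + v) / 4) ^ s * (w / 2) ^ (t - 2 * s) := by
  rw [sum_Z_eq_sum_packing, sum_fin_packing_eq, packingSum_eq, ← mul_assoc,
    one_div_mul_cancel (by positivity), one_mul]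
end

section
/- For all integers N, s, t with N ≥ 1, 1 ≤ s ≤ ⌊t/2⌋, and 1 ≤ t ≤ N, the ratio s·C(2s, s) / ( N·C(N−1, t−s−1) ) satisfies C₁·2^{2s}/(2^N √N) ≤ s·C(2s, s) / ( N·C(N−1, t−s−1) ) ≤ 2^{2s}/√N, where C₁ = e^{−1/6}·√(2/π). -/
/-- A sharp-order upper bound for the central binomial coefficient. -/
theorem centralBinom_sq_mul_le (m : ℕ) :
    m.centralBinom ^ 2 * (2 * m + 1) ≤ 16 ^ m := by
  induction m with
  | zero => simp
  | succ m ih =>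
    have h := Nat.succ_mul_centralBinom_succ m
    refine Nat.le_of_mul_le_mul_left ?_ (show 0 < (m + 1) ^ 2 by positivity)
    calc (m + 1) ^ 2 * ((m + 1).centralBinom ^ 2 * (2 * (m + 1) + 1))
        = ((m + 1) * (m + 1).centralBinom) ^ 2 * (2 * m + 3) := by ring
      _ = (m.centralBinom ^ 2 * (2 * m + 1)) * (4 * ((2 * m + 1) * (2 * m + 3))) := by
        rw [h]; ring
      _ ≤ 16 ^ m * (4 * (4 * (m + 1) ^ 2)) :=
        Nat.mul_le_mul ih (by nlinarith)
      _ = (m + 1) ^ 2 * 16 ^ (m + 1) := by ring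

/-- Every binomial coefficient in row `n` is at most `2 ^ n / √(n + 1)`. -/
theorem choose_sq_mul_succ_le (n k : ℕ) : n.choose k ^ 2 * (n + 1) ≤ 4 ^ n := by
  rcases Nat.even_or_odd' n with ⟨m, rfl | rfl⟩
  · calc (2 * m).choose k ^ 2 * (2 * m + 1) ≤ m.centralBinom ^ 2 * (2 * m + 1) := by
          gcongr
          exact Nat.choose_le_centralBinom k m
      _ ≤ 16 ^ m := centralBinom_sq_mul_le m
      _ = 4 ^ (2 * m) := by rw [pow_mul]; norm_num
  · have hk : (2 * m + 1).choose k ≤ (2 * m + 1).choose m := by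
      have h := Nat.choose_le_middle k (2 * m + 1)
      rwa [show (2 * m + 1) / 2 = m by omega] at h
    have hc : (m + 1).centralBinom = 2 * (2 * m + 1).choose m := by
      rw [Nat.centralBinom_eq_two_mul_choose, show 2 * (m + 1) = 2 * m + 1 + 1 by ring,
        Nat.choose_succ_succ, Nat.choose_symm_half]
      ring
    have h := centralBinom_sq_mul_le (m + 1)
    rw [hc] at h
    have hp : (4 : ℕ) ^ (2 * m + 1) * 4 = 16 ^ (m + 1) := by
      rw [← pow_succ, show 2 * m + 1 + 1 = 2 * (m + 1) by ring, pow_mul]; norm_num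
    have hk2 : (2 * m + 1).choose k ^ 2 * (2 * m + 1 + 1) ≤
        (2 * m + 1).choose m ^ 2 * (2 * m + 1 + 1) := by gcongr
    nlinarith [sq_nonneg ((2 * m + 1).choose m)]

/-- Formula (2.13): two-sided bounds for the ratio `s C(2s,s) / (N C(N-1, t-s-1))`. -/
theorem binom_ratio_two_sided_bounds
    (N s t : ℕ) (hN : 1 ≤ N) (hs : 1 ≤ s) (hst : s ≤ t / 2) (ht : 1 ≤ t) (htN : t ≤ N)
    (C₁ : ℝ) (hC₁ : C₁ = Real.exp (-(1 / 6 : ℝ)) * Real.sqrt (2 / Real.pi)) :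
    C₁ * 2 ^ (2 * s) / (2 ^ N * Real.sqrt N) ≤
        (s * (2 * s).choose s : ℝ) / (N * (N - 1).choose (t - s - 1)) ∧
      (s * (2 * s).choose s : ℝ) / (N * (N - 1).choose (t - s - 1)) ≤
        2 ^ (2 * s) / Real.sqrt N := by
  have hC : C₁ ≤ 1 := by
    rw [hC₁]
    refine mul_le_one₀ (Real.exp_le_one_iff.mpr (by norm_num)) (Real.sqrt_nonneg _) ?_
    rw [Real.sqrt_le_iff, one_pow]
    refine ⟨zero_le_one, ?_⟩
    rw [div_le_one Real.pi_pos]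
    exact Real.two_le_pi
  obtain ⟨n, rfl⟩ : ∃ n, N = n + 1 := ⟨N - 1, by omega⟩
  rw [Nat.add_sub_cancel, ← Nat.centralBinom_eq_two_mul_choose]
  have hc1 : (1 : ℝ) ≤ n.choose (t - s - 1) := by
    exact_mod_cast Nat.choose_pos (show t - s - 1 ≤ n by omega)
  have hc : (n.choose (t - s - 1) : ℝ) ^ 2 * ((n + 1 : ℕ) : ℝ) ≤ 4 ^ n := by
    exact_mod_cast choose_sq_mul_succ_le n (t - s - 1)
  have hb : (s.centralBinom : ℝ) ^ 2 * s ≤ 16 ^ s := by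
    have h : s.centralBinom ^ 2 * s ≤ 16 ^ s :=
      le_trans (Nat.mul_le_mul_left _ (by omega)) (centralBinom_sq_mul_le s)
    exact_mod_cast h
  have hb' : (2 : ℝ) ^ (2 * s) ≤ 2 * s * s.centralBinom := by
    rw [pow_mul]
    norm_num
    exact_mod_cast Nat.four_pow_le_two_mul_self_mul_centralBinom s hs
  have hsN : (s : ℝ) ≤ ((n + 1 : ℕ) : ℝ) := by
    exact_mod_cast (show s ≤ n + 1 by omega)
  have hN0 : (0 : ℝ) < ((n + 1 : ℕ) : ℝ) := by positivity
  generalize (n.choose (t - s - 1) : ℝ) = c at *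
  generalize (s.centralBinom : ℝ) = b at *
  have hr2 : ((n + 1 : ℕ) : ℝ) = √((n + 1 : ℕ) : ℝ) ^ 2 := (Real.sq_sqrt hN0.le).symm
  have hr : 0 < √((n + 1 : ℕ) : ℝ) := Real.sqrt_pos.mpr hN0
  have hc0 : 0 < c := by linarith
  constructor
  · rw [div_le_div_iff₀ (by positivity) (by positivity)]
    have hrc : √((n + 1 : ℕ) : ℝ) * c ≤ 2 ^ n := by
      refine le_of_pow_le_pow_left₀ two_ne_zero (by positivity) ?_
      rw [mul_pow, ← hr2, ← pow_mul, mul_comm n 2, pow_mul]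
      norm_num at hc ⊢
      linarith
    calc C₁ * 2 ^ (2 * s) * (((n + 1 : ℕ) : ℝ) * c)
        ≤ 1 * 2 ^ (2 * s) * (((n + 1 : ℕ) : ℝ) * c) := by gcongr
      _ = 2 ^ (2 * s) * √((n + 1 : ℕ) : ℝ) * (√((n + 1 : ℕ) : ℝ) * c) := by
        nth_rewrite 1 [hr2]; ring
      _ ≤ (2 * s * b) * √((n + 1 : ℕ) : ℝ) * 2 ^ n := by
        gcongr
        exact mul_nonneg (le_trans (by positivity) hb') hr.le
      _ = s * b * (2 ^ (n + 1) * √((n + 1 : ℕ) : ℝ)) := by ring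
  · rw [div_le_div_iff₀ (by positivity) hr]
    have hsb : s * b ≤ 2 ^ (2 * s) * √((n + 1 : ℕ) : ℝ) := by
      refine le_of_pow_le_pow_left₀ two_ne_zero (by positivity) ?_
      have h16 : ((2 : ℝ) ^ (2 * s)) ^ 2 = 16 ^ s := by
        rw [← pow_mul, show 2 * s * 2 = 4 * s by ring, pow_mul]; norm_num
      rw [mul_pow _ (√_), ← hr2, h16]
      calc (s * b) ^ 2 = b ^ 2 * s * s := by ring
        _ ≤ 16 ^ s * ((n + 1 : ℕ) : ℝ) := by gcongr
    calc s * b * √((n + 1 : ℕ) : ℝ)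
        ≤ 2 ^ (2 * s) * √((n + 1 : ℕ) : ℝ) * √((n + 1 : ℕ) : ℝ) := by gcongr
      _ = 2 ^ (2 * s) * (((n + 1 : ℕ) : ℝ) * 1) := by
        nth_rewrite 3 [hr2]; ring
      _ ≤ 2 ^ (2 * s) * (((n + 1 : ℕ) : ℝ) * c) := by gcongr
end

section
/- For every N ≥ 1 and all u, v, w ∈ (0,∞), the explicit sum S_N(u,v,w) = 1 + Σ_{t=1}^{N} Σ_{s=1}^{⌊t/2⌋} C(N−t+s, s)·C(t−s−1, s−1)·((u+v)/4)^s·(w/2)^{t−2s} satisfies the upper bound S_N(u,v,w) ≤ 1 − 1/√N + (1/√N)·(√(u+v) + w/2 + 1)^N. -/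
theorem Nat.le_choose_of_pos_of_lt {n k : ℕ} (hk : 0 < k) (hkn : k < n) : n ≤ n.choose k := by
  induction n generalizing k with
  | zero => omega
  | succ n ih =>
    obtain ⟨j, rfl⟩ := Nat.exists_eq_add_of_le' hk
    rcases Nat.lt_or_ge (j + 1) n with h | h
    · have h1 : n ≤ n.choose (j + 1) := ih (Nat.succ_pos j) h
      have h2 : 0 < n.choose j := Nat.choose_pos (by omega)
      rw [Nat.choose_succ_succ']
      omega
    · obtain rfl : n = j + 1 := by omega
      rw [Nat.choose_symm_of_eq_add (b := 1) (by omega), Nat.choose_one_right]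

open Nat in
/-- Two ways of splitting `a + b + 2 * s` elements into blocks of sizes `a`, `s`, `b`, `s`. -/
theorem Nat.choose_mul_choose_mul_centralBinom (a b s : ℕ) :
    (a + b + 2 * s).choose (b + 2 * s) * (b + 2 * s).choose (2 * s) * s.centralBinom =
      (a + b + 2 * s).choose (a + s) * (a + s).choose s * (b + s).choose s := by
  have h1 := Nat.add_choose_mul_factorial_mul_factorial a (b + 2 * s)
  have h2 := Nat.add_choose_mul_factorial_mul_factorial b (2 * s)
  have h3 := Nat.add_choose_mul_factorial_mul_factorial s s
  have h4 := Nat.add_choose_mul_factorial_mul_factorial (a + s) (b + s)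
  have h5 := Nat.add_choose_mul_factorial_mul_factorial a s
  have h6 := Nat.add_choose_mul_factorial_mul_factorial b s
  rw [← Nat.choose_symm_add] at h4
  rw [← two_mul] at h3
  rw [show a + s + (b + s) = a + b + 2 * s by ring] at h4
  rw [← add_assoc] at h1
  rw [Nat.centralBinom_eq_two_mul_choose]
  have hpos : 0 < a ! * b ! * s ! * s ! := by positivity
  refine Nat.eq_of_mul_eq_mul_right hpos ?_
  calc _ = (a + b + 2 * s).choose (b + 2 * s) * a ! * ((b + 2 * s).choose (2 * s) * b ! *
        ((2 * s).choose s * s ! * s !)) := by ring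
    _ = (a + b + 2 * s).choose (a + s) * ((a + s).choose s * a ! * s !) *
        ((b + s).choose s * b ! * s !) := by rw [h3, h2, h1, h5, h6, h4]
    _ = _ := by ring

theorem Nat.choose_mul_choose_mul_le_four_pow_mul (a b s : ℕ) (hs : 1 ≤ s) :
    (a + s).choose s * (b + s - 1).choose (s - 1) * (a + b + 2 * s) ≤
      4 ^ s * ((a + b + 2 * s).choose (b + 2 * s) * (b + 2 * s).choose (2 * s)) := by
  have h1 : (b + s - 1).choose (s - 1) ≤ (b + s).choose s := by
    obtain ⟨r, rfl⟩ := Nat.exists_eq_add_of_le' hs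
    rw [← add_assoc, Nat.add_sub_cancel, Nat.add_sub_cancel, Nat.choose_succ_succ']
    omega
  have h2 : a + b + 2 * s ≤ (a + b + 2 * s).choose (a + s) :=
    Nat.le_choose_of_pos_of_lt (by omega) (by omega)
  have h3 : s.centralBinom ≤ 4 ^ s := by
    rw [Nat.centralBinom_eq_two_mul_choose, show (4 : ℕ) = 2 ^ 2 by norm_num, ← pow_mul]
    exact Nat.choose_le_two_pow _ _
  calc _ ≤ (a + s).choose s * (b + s).choose s * (a + b + 2 * s).choose (a + s) := by gcongr
    _ = s.centralBinom *
        ((a + b + 2 * s).choose (b + 2 * s) * (b + 2 * s).choose (2 * s)) := by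
      rw [mul_comm s.centralBinom, Nat.choose_mul_choose_mul_centralBinom]; ring
    _ ≤ _ := by gcongr

theorem Finset.sum_even_choose_mul_pow_le_add_pow {x y : ℝ} (hx : 0 ≤ x) (hy : 0 ≤ y) (t : ℕ) :
    ∑ s ∈ Finset.Icc 1 (t / 2), (t.choose (2 * s) : ℝ) * x ^ (2 * s) * y ^ (t - 2 * s) ≤
      (x + y) ^ t := by
  rw [add_pow, ← Finset.sum_image (s := Finset.Icc 1 (t / 2)) (g := fun s => 2 * s)
    (f := fun k => (t.choose k : ℝ) * x ^ k * y ^ (t - k)) (by intro a _ b _ h; simpa using h)]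
  calc _ ≤ ∑ k ∈ Finset.range (t + 1), (t.choose k : ℝ) * x ^ k * y ^ (t - k) := by
        refine Finset.sum_le_sum_of_subset_of_nonneg ?_ fun _ _ _ => by positivity
        intro k hk
        simp only [Finset.mem_image, Finset.mem_Icc, Finset.mem_range] at hk ⊢
        omega
    _ = _ := Finset.sum_congr rfl fun _ _ => by ring

theorem one_add_pow_eq_one_add_sum_Icc (z : ℝ) (N : ℕ) :
    (z + 1) ^ N = 1 + ∑ t ∈ Finset.Icc 1 N, (N.choose t : ℝ) * z ^ t := by
  rw [add_pow, Finset.range_eq_Ico, Finset.sum_eq_sum_Ico_succ_bot (Nat.succ_pos N)]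
  simp only [pow_zero, one_pow, mul_one, Nat.choose_zero_right, Nat.cast_one, zero_add]
  congr 1
  exact Finset.sum_congr (by ext; simp) fun _ _ => mul_comm _ _

/-- Upper bound of Theorem 2.1 for the explicit sum `S_N`. -/
theorem explicit_sum_upper_bound
    (N : ℕ) (hN : 1 ≤ N) (u v w : ℝ) (hu : 0 < u) (hv : 0 < v) (hw : 0 < w)
    (S : ℝ)
    (hS : S = 1 + ∑ t ∈ Finset.Icc 1 N, ∑ s ∈ Finset.Icc 1 (t / 2),
        ((N - t + s).choose s : ℝ) * ((t - s - 1).choose (s - 1)) *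
          ((u + v) / 4) ^ s * (w / 2) ^ (t - 2 * s)) :
    S ≤ 1 - 1 / Real.sqrt N +
        (1 / Real.sqrt N) * (Real.sqrt (u + v) + w / 2 + 1) ^ N := by
  have hN1 : (1 : ℝ) ≤ N := by exact_mod_cast hN
  have hsqrt : 0 < Real.sqrt N := Real.sqrt_pos.2 (by linarith)
  have hsqrt_le : Real.sqrt N ≤ N := Real.sqrt_le_self_iff.2 (Or.inr hN1)
  have key : ∑ t ∈ Finset.Icc 1 N, ∑ s ∈ Finset.Icc 1 (t / 2),
        ((N - t + s).choose s : ℝ) * ((t - s - 1).choose (s - 1)) *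
          ((u + v) / 4) ^ s * (w / 2) ^ (t - 2 * s) ≤
      1 / Real.sqrt N *
        ∑ t ∈ Finset.Icc 1 N, (N.choose t : ℝ) * (Real.sqrt (u + v) + w / 2) ^ t := by
    rw [Finset.mul_sum]
    refine Finset.sum_le_sum fun t ht => ?_
    calc _ ≤ 1 / Real.sqrt N * (N.choose t * ∑ s ∈ Finset.Icc 1 (t / 2),
          (t.choose (2 * s) : ℝ) * Real.sqrt (u + v) ^ (2 * s) * (w / 2) ^ (t - 2 * s)) := by
          rw [Finset.mul_sum, Finset.mul_sum]
          refine Finset.sum_le_sum fun s hs => ?_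
          rw [Finset.mem_Icc] at hs ht
          have hcoef := Nat.choose_mul_choose_mul_le_four_pow_mul (N - t) (t - 2 * s) s hs.1
          rw [show N - t + (t - 2 * s) + 2 * s = N by omega,
            show t - 2 * s + s - 1 = t - s - 1 by omega,
            show t - 2 * s + 2 * s = t by omega] at hcoef
          have hcoef' : ((N - t + s).choose s : ℝ) * ((t - s - 1).choose (s - 1)) * N ≤
              4 ^ s * (N.choose t * t.choose (2 * s)) := by exact_mod_cast hcoef
          rw [pow_mul, Real.sq_sqrt (by positivity), div_pow, one_div_mul_eq_div,
            le_div_iff₀ hsqrt]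
          calc _ = ((N - t + s).choose s : ℝ) * ((t - s - 1).choose (s - 1)) * Real.sqrt N *
                ((u + v) ^ s / 4 ^ s * (w / 2) ^ (t - 2 * s)) := by ring
            _ ≤ 4 ^ s * (N.choose t * t.choose (2 * s)) *
                ((u + v) ^ s / 4 ^ s * (w / 2) ^ (t - 2 * s)) := by
              refine mul_le_mul_of_nonneg_right ?_ (by positivity)
              exact (mul_le_mul_of_nonneg_left hsqrt_le (by positivity)).trans hcoef'
            _ = _ := by field_simp
      _ ≤ _ := by
          gcongr
          exact Finset.sum_even_choose_mul_pow_le_add_pow (Real.sqrt_nonneg _) (by positivity) t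
  rw [hS, one_add_pow_eq_one_add_sum_Icc]
  linarith
end

section
/- Let u, v, w ∈ (0,∞) satisfy √(u+v) + w/2 > 1. Then the explicit sums S_N(u,v,w) = 1 + Σ_{t=1}^{N} Σ_{s=1}^{⌊t/2⌋} C(N−t+s, s)·C(t−s−1, s−1)·((u+v)/4)^s·(w/2)^{t−2s} diverge to +∞ as N → ∞; indeed S_N grows at least like ((√(u+v) + w/2 + 1)/2)^N / √N up to a positive constant factor, and (√(u+v) + w/2 + 1)/2 > 1. -/
open PowerSeries in
/-- The coefficients of `(1 - X)⁻¹ ^ (s + 2) * (1 - b X)⁻¹ ^ (s + 1)`. -/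
lemma coeff_mk_one_pow_mul_geom_pow (b : ℝ) (s n : ℕ) :
    coeff n ((mk 1 : ℝ⟦X⟧) ^ (s + 2) * (rescale b (mk 1)) ^ (s + 1)) =
      ∑ j ∈ Finset.range (n + 1),
        ((n - j + (s + 1)).choose (s + 1) : ℝ) * ((j + s).choose s) * b ^ j := by
  rw [mul_comm, coeff_mul, Finset.Nat.sum_antidiagonal_eq_sum_range_succ_mk]
  refine Finset.sum_congr rfl fun j _ => ?_
  rw [← map_pow, mk_one_pow_eq_mk_choose_add, mk_one_pow_eq_mk_choose_add, coeff_rescale,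
    coeff_mk, coeff_mk, Nat.add_comm s j, Nat.add_comm (s + 1) (n - j)]
  ring

open PowerSeries in
/-- The partial sums in `s` of the generating function of the explicit sums. -/
noncomputable def truncatedGenFun (d b : ℝ) (M : ℕ) : ℝ⟦X⟧ :=
  ∑ s ∈ Finset.range M,
    C d ^ s * (X ^ (2 * s) * ((mk 1) ^ (s + 1) * (rescale b (mk 1)) ^ s))

open PowerSeries in
lemma truncatedGenFun_succ (d b : ℝ) (M : ℕ) :
    (1 - X) * (1 - C b * X) * truncatedGenFun d b (M + 1) =
      (1 - C b * X) + C d * (X ^ 2 * truncatedGenFun d b M) := by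
  have hP : (mk 1 : ℝ⟦X⟧) * (1 - X) = 1 := mk_one_mul_one_sub_eq_one ℝ
  have hQ : rescale b (mk 1 : ℝ⟦X⟧) * (1 - C b * X) = 1 := by
    have := congrArg (rescale b) hP
    simpa [rescale_X] using this
  have key : truncatedGenFun d b (M + 1) =
      mk 1 + C d * X ^ 2 * mk 1 * rescale b (mk 1) * truncatedGenFun d b M := by
    rw [truncatedGenFun, Finset.sum_range_succ', truncatedGenFun, Finset.mul_sum, add_comm]
    congr 1
    · simp
    · exact Finset.sum_congr rfl fun s _ => by ring
  rw [key]
  linear_combination (1 - C b * X) * hP +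
    C d * X ^ 2 * truncatedGenFun d b M * (rescale b (mk 1 : ℝ⟦X⟧) * (1 - C b * X)) * hP +
    C d * X ^ 2 * truncatedGenFun d b M * hQ

open PowerSeries in
lemma coeff_truncatedGenFun (d b : ℝ) {N M : ℕ} (hM : N ≤ M) :
    coeff N (truncatedGenFun d b (M + 1)) =
      1 + ∑ t ∈ Finset.Icc 1 N, ∑ s ∈ Finset.Icc 1 (t / 2),
        ((N - t + s).choose s : ℝ) * ((t - s - 1).choose (s - 1)) *
          d ^ s * b ^ (t - 2 * s) := by
  have hswap : ∑ t ∈ Finset.Icc 1 N, ∑ s ∈ Finset.Icc 1 (t / 2),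
        ((N - t + s).choose s : ℝ) * ((t - s - 1).choose (s - 1)) * d ^ s * b ^ (t - 2 * s) =
      ∑ s ∈ Finset.Ico 1 (M + 1), ∑ t ∈ Finset.Ico (2 * s) (N + 1),
        ((N - t + s).choose s : ℝ) * ((t - s - 1).choose (s - 1)) * d ^ s * b ^ (t - 2 * s) := by
    refine Finset.sum_comm' fun t s => ?_
    simp only [Finset.mem_Icc, Finset.mem_Ico]
    omega
  rw [hswap, truncatedGenFun, Finset.sum_range_succ', Finset.sum_Ico_eq_sum_range, map_add,
    add_comm, map_sum]
  congr 1
  · simp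
  refine Finset.sum_congr rfl fun s _ => ?_
  rw [← map_pow, coeff_C_mul, coeff_X_pow_mul', Finset.sum_Ico_eq_sum_range]
  split_ifs with hs
  · rw [coeff_mk_one_pow_mul_geom_pow, Finset.mul_sum,
      show N + 1 - 2 * (1 + s) = N - 2 * (s + 1) + 1 by omega]
    refine Finset.sum_congr rfl fun j hj => ?_
    rw [show N - (2 * (1 + s) + j) + (1 + s) = N - 2 * (s + 1) - j + (s + 1) by omega,
      show 2 * (1 + s) + j - (1 + s) - 1 = j + s by omega,
      show 2 * (1 + s) + j - 2 * (1 + s) = j by omega,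
      show 1 + s = s + 1 by omega, Nat.add_sub_cancel]
    ring
  · rw [show N + 1 - 2 * (1 + s) = 0 by omega]
    simp

open PowerSeries in
/-- The explicit sums satisfy a second-order linear recurrence. -/
lemma explicit_sum_recurrence (d b : ℝ) (S : ℕ → ℝ)
    (hS : ∀ N, S N = 1 + ∑ t ∈ Finset.Icc 1 N, ∑ s ∈ Finset.Icc 1 (t / 2),
        ((N - t + s).choose s : ℝ) * ((t - s - 1).choose (s - 1)) *
          d ^ s * b ^ (t - 2 * s)) (N : ℕ) :
    S (N + 2) - S (N + 1) = b * (S (N + 1) - S N) + d * S N := by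
  have hc : ∀ n M, n ≤ M → coeff n (truncatedGenFun d b (M + 1)) = S n := fun n M hn => by
    rw [coeff_truncatedGenFun d b hn, hS]
  have h := congrArg (coeff (N + 2)) (truncatedGenFun_succ d b (N + 3))
  rw [show (1 - X) * (1 - C b * X) * truncatedGenFun d b (N + 3 + 1) =
      truncatedGenFun d b (N + 3 + 1) - X ^ 1 * truncatedGenFun d b (N + 3 + 1) -
        C b * (X ^ 1 * truncatedGenFun d b (N + 3 + 1)) +
        C b * (X ^ 2 * truncatedGenFun d b (N + 3 + 1)) by ring] at h
  simp only [map_add, map_sub, coeff_C_mul, coeff_X_pow_mul', coeff_one, coeff_X] at h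
  simp only [show 1 ≤ N + 2 by omega, show 2 ≤ N + 2 by omega, if_true,
    show N + 2 - 1 = N + 1 by omega, Nat.add_sub_cancel, hc (N + 2) (N + 3) (by omega),
    hc (N + 1) (N + 3) (by omega), hc N (N + 3) (by omega), hc N (N + 2) (by omega)] at h
  simp at h
  linarith

/-- Nonnegative solutions of the recurrence grow at least geometrically, at the rate given by
the larger characteristic root. -/
lemma exists_mul_pow_le_of_recurrence {d b lam : ℝ} (hd : 0 < d) (hb : 0 < b) (hlam : 1 < lam)
    (hroot : (lam - 1) * (lam - b) = d) (S : ℕ → ℝ) (h0 : S 0 = 1) (h1 : S 1 = 1)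
    (hrec : ∀ N, S (N + 2) - S (N + 1) = b * (S (N + 1) - S N) + d * S N) :
    ∃ c : ℝ, 0 < c ∧ ∀ N, c * lam ^ N ≤ S N := by
  have hpos : ∀ N, 0 ≤ S N ∧ 0 ≤ S (N + 1) - S N := by
    intro N
    induction N with
    | zero => simp [h0, h1]
    | succ N ih =>
      refine ⟨by linarith, ?_⟩
      rw [hrec]
      have := mul_nonneg hb.le ih.2
      have := mul_nonneg hd.le ih.1
      linarith
  have hW : ∀ N, d * S N + (lam - 1) * (S (N + 1) - S N) = d * lam ^ N := by
    intro N
    induction N with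
    | zero => simp [h0, h1]
    | succ N ih =>
      rw [hrec, pow_succ, ← mul_assoc, ← ih]
      linear_combination (-(S (N + 1) - S N)) * hroot
  have hl : 0 < lam := by linarith
  have hK : 0 < d + (lam - 1) := by linarith
  refine ⟨d / (d + (lam - 1)) / lam, by positivity, fun N => ?_⟩
  rw [div_div, div_mul_eq_mul_div, div_le_iff₀ (by positivity)]
  cases N with
  | zero => rw [h0]; nlinarith
  | succ N =>
    obtain ⟨p, q⟩ := hpos N
    have h2 : d * lam ^ N ≤ (d + (lam - 1)) * S (N + 1) := by
      rw [← hW]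
      have := mul_nonneg hd.le q
      have := mul_nonneg (sub_nonneg.2 hlam.le) p
      linarith
    calc d * lam ^ (N + 1) = d * lam ^ N * lam := by ring
      _ ≤ (d + (lam - 1)) * S (N + 1) * lam := by gcongr
      _ = S (N + 1) * ((d + (lam - 1)) * lam) := by ring

/-- Remark 2.1: when `√(u+v) + w/2 > 1`, the explicit sums `S_N` diverge to `+∞`,
growing at least like `((√(u+v)+w/2+1)/2)^N / √N` up to a positive constant. -/
theorem explicit_sum_diverges
    (u v w : ℝ) (hu : 0 < u) (hv : 0 < v) (hw : 0 < w)
    (h : 1 < Real.sqrt (u + v) + w / 2)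
    (S : ℕ → ℝ)
    (hS : ∀ N, S N = 1 + ∑ t ∈ Finset.Icc 1 N, ∑ s ∈ Finset.Icc 1 (t / 2),
        ((N - t + s).choose s : ℝ) * ((t - s - 1).choose (s - 1)) *
          ((u + v) / 4) ^ s * (w / 2) ^ (t - 2 * s)) :
    Filter.Tendsto S Filter.atTop Filter.atTop ∧
      (∃ c : ℝ, 0 < c ∧ ∀ N : ℕ, 1 ≤ N →
        c * ((Real.sqrt (u + v) + w / 2 + 1) / 2) ^ N / Real.sqrt N ≤ S N) ∧
      1 < (Real.sqrt (u + v) + w / 2 + 1) / 2 := by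
  have hmu : 1 < (Real.sqrt (u + v) + w / 2 + 1) / 2 := by linarith
  set mu := (Real.sqrt (u + v) + w / 2 + 1) / 2 with hmu_def
  set r := Real.sqrt ((1 - w / 2) ^ 2 + (u + v)) with hr
  have hr2 : r ^ 2 = (1 - w / 2) ^ 2 + (u + v) := Real.sq_sqrt (by positivity)
  have hle : mu ≤ (1 + w / 2 + r) / 2 := by
    have : Real.sqrt (u + v) ≤ r := Real.sqrt_le_sqrt (by nlinarith [sq_nonneg (1 - w / 2)])
    linarith
  obtain ⟨c, hc, hcS⟩ := exists_mul_pow_le_of_recurrence (d := (u + v) / 4) (b := w / 2)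
    (lam := (1 + w / 2 + r) / 2) (by positivity) (by positivity) (by linarith)
    (by linear_combination hr2 / 4) S (by simp [hS]) (by simp [hS])
    (explicit_sum_recurrence _ _ S hS)
  have hbound : ∀ N, c * mu ^ N ≤ S N := fun N =>
    le_trans (by gcongr) (hcS N)
  refine ⟨Filter.tendsto_atTop_mono hbound
    ((tendsto_pow_atTop_atTop_of_one_lt hmu).const_mul_atTop hc), ⟨c, hc, fun N hN => ?_⟩, hmu⟩
  refine le_trans (div_le_self (by positivity) ?_) (hbound N)
  rw [Real.one_le_sqrt]
  exact_mod_cast hN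
end
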